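/- Let m₁,…,m₅ be five pairwise distinct points of ℝ³ that are not coplanar. Then it is impossible that for every pair of indices i ≠ j at least one of the following holds: (1) there exist a line L and r > 0 such that all five points lie on the cylinder of revolution with axis L and radius r and the line through mᵢ and mⱼ is a ruling of this cylinder; (2) there exists a line skew to the line through mᵢ and mⱼ (i.e., disjoint from it and with a different direction) such that all five points lie on the union of these two lines. -/

import Mathlib

open Metric

noncomputable section

local notation "E3" => EuclideanSpace ℝ (Fin 3)

/-- A line in `ℝ³` is a one-dimensional affine subspace. -/
def IsLine (L : AffineSubspace ℝ (EuclideanSpace ℝ (Fin 3))) : Prop :=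
  Module.finrank ℝ L.direction = 1

/-- The cylinder of revolution with axis `L` and radius `r`. -/
def Cylinder (L : AffineSubspace ℝ (EuclideanSpace ℝ (Fin 3))) (r : ℝ) :
    Set (EuclideanSpace ℝ (Fin 3)) :=
  {x | Metric.infDist x (L : Set (EuclideanSpace ℝ (Fin 3))) = r}

/-- Squared norm of the cross product of `u` and `x`. -/
def QQ (u x : EuclideanSpace ℝ (Fin 3)) : ℝ :=
  inner ℝ u u * inner ℝ x x - inner ℝ u x * inner ℝ u x

theorem exists_param (L : AffineSubspace ℝ (EuclideanSpace ℝ (Fin 3))) (hL : IsLine L)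
    (p : EuclideanSpace ℝ (Fin 3)) (hp : p ∈ L) :
    ∃ v : EuclideanSpace ℝ (Fin 3), v ∈ L.direction ∧ inner ℝ v v = (1:ℝ) ∧
      ∀ x ∈ L, ∃ t : ℝ, x = p + t • v := by
  obtain ⟨v, hv0, hv⟩ := finrank_eq_one_iff'.1 hL
  have hn : ‖(v : EuclideanSpace ℝ (Fin 3))‖ ≠ 0 := by simpa using hv0
  refine ⟨‖(v : EuclideanSpace ℝ (Fin 3))‖⁻¹ • (v : EuclideanSpace ℝ (Fin 3)),
    L.direction.smul_mem _ v.2, ?_, ?_⟩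
  · rw [real_inner_self_eq_norm_sq, norm_smul]
    simp [hn]
  · intro x hx
    obtain ⟨c, hc⟩ := hv ⟨x - p, L.vsub_mem_direction hx hp⟩
    have hc' : c • (v : EuclideanSpace ℝ (Fin 3)) = x - p := congrArg Subtype.val hc
    refine ⟨c * ‖(v : EuclideanSpace ℝ (Fin 3))‖, ?_⟩
    rw [smul_smul, mul_assoc, mul_inv_cancel₀ hn, mul_one, hc']
    abel

theorem QQ_zero {u x : EuclideanSpace ℝ (Fin 3)} (hu : u ≠ 0) (h : QQ u x = 0) :
    ∃ t : ℝ, x = t • u := by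
  have hU : (inner ℝ u u : ℝ) ≠ 0 := by simpa using hu
  refine ⟨inner ℝ u x / inner ℝ u u, ?_⟩
  rw [← sub_eq_zero, ← inner_self_eq_zero (𝕜 := ℝ)]
  simp only [inner_sub_left, inner_sub_right, inner_smul_left, inner_smul_right,
    real_inner_comm u x, QQ] at h ⊢
  simp only [conj_trivial]
  field_simp
  linarith

theorem QQ_symm1 (a b c : EuclideanSpace ℝ (Fin 3)) : QQ (b - a) (c - a) = QQ (c - a) (b - a) := by
  simp only [QQ, real_inner_comm (b - a) (c - a)]
  ring

theorem QQ_symm2 (a b c : EuclideanSpace ℝ (Fin 3)) : QQ (b - a) (c - a) = QQ (a - b) (c - b) := by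
  simp only [QQ, inner_sub_left, inner_sub_right, real_inner_comm a b, real_inner_comm a c,
    real_inner_comm b c]
  ring

theorem cyl_lin (L : AffineSubspace ℝ (EuclideanSpace ℝ (Fin 3))) (r : ℝ) (hL : IsLine L)
    (hr : 0 < r) (a b : EuclideanSpace ℝ (Fin 3))
    (hab : (affineSpan ℝ ({a, b} : Set (EuclideanSpace ℝ (Fin 3))) :
      Set (EuclideanSpace ℝ (Fin 3))) ⊆ Cylinder L r) :
    ∃ f : EuclideanSpace ℝ (Fin 3) →ₗ[ℝ] ℝ, ∀ x ∈ Cylinder L r,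
      QQ (b - a) (x - a) = f (x - a) := by
  have hne : (L : Set (EuclideanSpace ℝ (Fin 3))).Nonempty := by
    by_contra h
    rw [Set.not_nonempty_iff_eq_empty] at h
    have := hab (left_mem_affineSpan_pair ℝ a b)
    simp only [Cylinder, h, Set.mem_setOf_eq, Metric.infDist_empty] at this
    linarith
  obtain ⟨p, hp⟩ := hne
  obtain ⟨v, hvL, hv, hpar⟩ := exists_param L hL p hp
  have : Nonempty L := ⟨⟨p, hp⟩⟩
  have key : ∀ x ∈ Cylinder L r,
      inner ℝ (x - p) (x - p) - inner ℝ v (x - p) * inner ℝ v (x - p) = r ^ 2 := by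
    intro x hx
    have hx' : Metric.infDist x (L : Set (EuclideanSpace ℝ (Fin 3))) = r := hx
    rw [← EuclideanGeometry.dist_orthogonalProjection_eq_infDist] at hx'
    obtain ⟨t, ht⟩ := hpar _ (EuclideanGeometry.orthogonalProjection_mem (s := L) x)
    have ho := EuclideanGeometry.vsub_orthogonalProjection_mem_direction_orthogonal L x
    rw [Submodule.mem_orthogonal] at ho
    have ho := ho v hvL
    rw [ht] at hx' ho
    rw [dist_comm, dist_eq_norm, norm_sub_rev] at hx'
    rw [← hx', ← real_inner_self_eq_norm_sq]
    simp only [vsub_eq_sub] at ho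
    rw [show x - (p + t • v) = (x - p) - t • v by abel] at ho ⊢
    simp only [inner_sub_left (x - p), inner_sub_right _ (x - p) (t • v), inner_smul_left,
      inner_smul_right, hv, real_inner_comm v (x - p)] at ho ⊢
    simp only [conj_trivial]
    have : inner ℝ v (x - p) = t := by linarith
    rw [this]; ring
  have hl : ∀ t : ℝ, a + t • (b - a) ∈ Cylinder L r := by
    intro t
    apply hab
    have := AffineMap.lineMap_mem_affineSpan_pair t a b
    rw [AffineMap.lineMap_apply] at this
    simpa [add_comm] using this
  set u := b - a with hu
  have h0 := key _ (hl 0)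
  have h1 := key _ (hl 1)
  have h2 := key _ (hl (-1))
  have e : ∀ t : ℝ, a + t • u - p = (a - p) + t • u := by intro t; abel
  simp only [e, inner_add_left, inner_add_right _ (a - p), inner_smul_left, inner_smul_right,
    conj_trivial, real_inner_comm u (a - p)] at h0 h1 h2
  have huv : inner ℝ u u = inner ℝ v u * inner ℝ v u := by linarith
  have hus : u = (inner ℝ v u : ℝ) • v := by
    rw [← sub_eq_zero, ← inner_self_eq_zero (𝕜 := ℝ)]
    simp only [inner_sub_left, inner_sub_right, inner_smul_left, inner_smul_right,
      conj_trivial, hv, real_inner_comm v u]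
    linarith
  set s : ℝ := inner ℝ v u with hs
  refine ⟨(-2 : ℝ) • (s ^ 2 • (innerₛₗ ℝ (a - p)) - (s ^ 2 * inner ℝ v (a - p)) • innerₛₗ ℝ v), ?_⟩
  intro x hx
  have h3 := key x hx
  have h4 := key a (by simpa using hl 0)
  rw [show x - p = (a - p) + (x - a) by abel] at h3
  have hux : ∀ y, inner ℝ u y = s * inner ℝ v y := by
    intro y
    conv_lhs => rw [hus]
    rw [inner_smul_left, conj_trivial]
  simp only [inner_add_left (a - p), inner_add_right _ (a - p), real_inner_comm (a - p) (x - a)] at h3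
  simp only [QQ, huv, hux, LinearMap.smul_apply, LinearMap.sub_apply, innerₛₗ_apply_apply,
    smul_eq_mul]
  linear_combination s ^ 2 * h3 - s ^ 2 * h4

theorem mem_span_pair {a b c : EuclideanSpace ℝ (Fin 3)}
    (h : c ∈ affineSpan ℝ ({a, b} : Set (EuclideanSpace ℝ (Fin 3)))) :
    ∃ t : ℝ, c - a = t • (b - a) := by
  rw [mem_affineSpan_pair_iff_exists_lineMap_eq] at h
  obtain ⟨t, rfl⟩ := h
  exact ⟨t, by simp [AffineMap.lineMap_apply]⟩

theorem QQ_smul (u : EuclideanSpace ℝ (Fin 3)) (t : ℝ) (x : EuclideanSpace ℝ (Fin 3)) :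
    QQ u (t • x) = t ^ 2 * QQ u x := by
  simp only [QQ, inner_smul_left, inner_smul_right, conj_trivial]; ring

theorem QQ_self (u : EuclideanSpace ℝ (Fin 3)) : QQ u u = 0 := by
  simp [QQ]

theorem line_three (L : AffineSubspace ℝ (EuclideanSpace ℝ (Fin 3))) (hL : IsLine L)
    {a b c : EuclideanSpace ℝ (Fin 3)} (ha : a ∈ L) (hb : b ∈ L) (hc : c ∈ L) (hab : a ≠ b) :
    ∃ t : ℝ, c - a = t • (b - a) := by
  obtain ⟨v, -, -, h⟩ := exists_param L hL a ha
  obtain ⟨s, rfl⟩ := h b hb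
  obtain ⟨t, rfl⟩ := h c hc
  have : s ≠ 0 := by rintro rfl; simp at hab
  refine ⟨t / s, ?_⟩
  simp only [add_sub_cancel_left, smul_smul]
  field_simp

theorem compl_pair : ∀ i j k : Fin 5, i ≠ j → i ≠ k → j ≠ k → ∃ l n : Fin 5,
    i ≠ l ∧ i ≠ n ∧ j ≠ l ∧ j ≠ n ∧ k ≠ l ∧ k ≠ n ∧ l ≠ n ∧
      (Finset.univ : Finset (Fin 5)) = {i, j, k, l, n} := by decide

theorem triple_zero (W : Fin 5 → Fin 5 → Fin 5 → ℝ) (h1 : ∀ i j k, W i j k = W i k j)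
    (h2 : ∀ i j k, W i j k = W j i k) (h3 : ∀ i j, W i j j = 0)
    (hs : ∀ i j, i ≠ j → ∑ k, W i j k = 0) (i j k : Fin 5) (hij : i ≠ j) (hik : i ≠ k)
    (hjk : j ≠ k) : W i j k = 0 := by
  obtain ⟨l, n, hil, hin, hjl, hjn, hkl, hkn, hln, hu⟩ := compl_pair i j k hij hik hjk
  have hs' : ∀ a b, a ≠ b → W a b i + W a b j + W a b k + W a b l + W a b n = 0 := by
    intro a b hab
    rw [← hs a b hab, hu, Finset.sum_insert, Finset.sum_insert, Finset.sum_insert,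
      Finset.sum_insert, Finset.sum_singleton]
    · ring
    all_goals simp [*]
  have h4 : ∀ a b, W a b a = 0 := fun a b => by rw [h1, h2, h1, h2, h1, h2, h1] <;> grind
  have e1 := hs' i j hij
  have e2 := hs' i k hik
  have e3 := hs' j k hjk
  have e4 := hs' i l hil
  have e5 := hs' j l hjl
  have e6 := hs' k l hkl
  have e7 := hs' i n hin
  have e8 := hs' j n hjn
  have e9 := hs' k n hkn
  have e10 := hs' l n hln
  grind

theorem main_aux (m : Fin 5 → EuclideanSpace ℝ (Fin 3)) (hm : Function.Injective m)
    (hnc : ∀ i j k, i ≠ j → i ≠ k → j ≠ k → QQ (m j - m i) (m k - m i) ≠ 0)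
    (hc : ∀ i j, i ≠ j → ∃ f : EuclideanSpace ℝ (Fin 3) →ₗ[ℝ] ℝ, ∀ k,
      QQ (m j - m i) (m k - m i) = f (m k - m i)) : False := by
  have hdep : ¬ AffineIndependent ℝ m := by
    intro h
    have := h.card_le_finrank_succ
    have h2 := Submodule.finrank_le (vectorSpan ℝ (Set.range m))
    simp at this h2
    omega
  rw [affineIndependent_iff_of_fintype] at hdep
  push Not at hdep
  obtain ⟨w, hw0, hw1, i, hi⟩ := hdep
  have hw2 : ∀ q, ∑ k, w k • (m k - q) = 0 := by
    intro q
    rw [Finset.weightedVSub_eq_weightedVSubOfPoint_of_sum_eq_zero _ _ _ hw0 q] at hw1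
    simpa using hw1
  have hsum : ∀ i j, i ≠ j → ∑ k, w k * QQ (m j - m i) (m k - m i) = 0 := by
    intro i j hij
    obtain ⟨f, hf⟩ := hc i j hij
    have := congrArg f (hw2 (m i))
    simp only [map_sum, map_smul, map_zero, smul_eq_mul] at this
    simpa [hf] using this
  have hz := triple_zero (fun i j k => w i * w j * w k * QQ (m j - m i) (m k - m i))
    (fun i j k => by rw [QQ_symm1]; ring)
    (fun i j k => by rw [QQ_symm2]; ring)
    (fun i j => by simp [QQ_self])
    (fun i j hij => by
      have := hsum i j hij
      calc _ = w i * w j * ∑ k, w k * QQ (m j - m i) (m k - m i) := by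
            rw [Finset.mul_sum]; exact Finset.sum_congr rfl fun _ _ => by ring
        _ = 0 := by rw [this, mul_zero])
  obtain ⟨j, hj, hji⟩ : ∃ j, w j ≠ 0 ∧ i ≠ j := by
    by_contra! h
    rw [Finset.sum_eq_single i (fun b _ hb => by
      by_contra h'; exact hb (h b h').symm) (by simp)] at hw0
    exact hi hw0
  obtain ⟨k, hk, hki, hkj⟩ : ∃ k, w k ≠ 0 ∧ i ≠ k ∧ j ≠ k := by
    by_contra! h
    have := hw2 (m i)
    rw [Finset.sum_eq_single j (fun b _ hb => by
      by_cases hbi : i = b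
      · simp [hbi]
      · by_cases hwb : w b = 0
        · simp [hwb]
        · exact absurd (h b hwb hbi).symm hb) (by simp)] at this
    rcases smul_eq_zero.1 this with h' | h'
    · exact hj h'
    · exact hji (hm (sub_eq_zero.1 h')).symm
  have := hz i j k hji hki hkj
  simp only [mul_eq_zero, hi, hj, hk, false_or] at this
  exact hnc i j k hji hki hkj this

/-- For five pairwise distinct non-coplanar points of `ℝ³` it is impossible that
for every pair of indices `i ≠ j` either all five points lie on a cylinder of
revolution having the line through `mᵢ` and `mⱼ` as a ruling, or all five points
lie on the union of the line through `mᵢ` and `mⱼ` and a line skew to it. -/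
theorem no_five_points_cylinder_or_skew_lines :
    ¬ ∃ m : Fin 5 → E3,
      Function.Injective m ∧
      (¬ Coplanar ℝ (Set.range m)) ∧
      (∀ i j : Fin 5, i ≠ j →
        (∃ (L : AffineSubspace ℝ E3) (r : ℝ), IsLine L ∧ 0 < r ∧
          (∀ k : Fin 5, m k ∈ Cylinder L r) ∧
          (affineSpan ℝ ({m i, m j} : Set E3) : Set E3) ⊆ Cylinder L r) ∨
        (∃ L' : AffineSubspace ℝ E3, IsLine L' ∧
          (L' : Set E3) ∩ (affineSpan ℝ ({m i, m j} : Set E3) : Set E3) = ∅ ∧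
          L'.direction ≠ (affineSpan ℝ ({m i, m j} : Set E3)).direction ∧
          (∀ k : Fin 5,
            m k ∈ (L' : Set E3) ∪ (affineSpan ℝ ({m i, m j} : Set E3) : Set E3)))) := by
  rintro ⟨m, hm, hcop, h⟩
  by_cases hcol : ∀ i j k, i ≠ j → i ≠ k → j ≠ k → QQ (m j - m i) (m k - m i) ≠ 0
  · refine main_aux m hm hcol ?_
    intro i j hij
    rcases h i j hij with ⟨L, r, hL, hr, hk, hab⟩ | ⟨L, hL, -, -, hk⟩
    · obtain ⟨f, hf⟩ := cyl_lin L r hL hr _ _ hab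
      exact ⟨f, fun k => hf _ (hk k)⟩
    · exfalso
      have hk' : ∀ k, i ≠ k → j ≠ k → m k ∈ L := by
        intro k hik hjk
        rcases hk k with h' | h'
        · exact h'
        · obtain ⟨t, ht⟩ := mem_span_pair h'
          exact absurd (by rw [ht, QQ_smul, QQ_self, mul_zero]) (hcol i j k hij hik hjk)
      obtain ⟨k, hik, hjk⟩ : ∃ k, i ≠ k ∧ j ≠ k := by
        have hd : ∀ i j : Fin 5, ∃ k, i ≠ k ∧ j ≠ k := by decide
        exact hd i j
      obtain ⟨l, n, hil, hin, hjl, hjn, hkl, hkn, hln, -⟩ := compl_pair i j k hij hik hjk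
      obtain ⟨t, ht⟩ := line_three L hL (hk' k hik hjk) (hk' l hil hjl) (hk' n hin hjn)
        (fun h => hkl (hm h))
      exact absurd (by rw [ht, QQ_smul, QQ_self, mul_zero]) (hcol k l n hkl hkn hln)
  · push Not at hcol
    obtain ⟨a, b, c, hab, hac, hbc, hQ⟩ := hcol
    obtain ⟨t, ht⟩ := QQ_zero (sub_ne_zero.2 fun h => hab (hm h).symm) hQ
    have ht0 : t ≠ 0 := by
      rintro rfl
      rw [zero_smul, sub_eq_zero] at ht
      exact hac (hm ht).symm
    have ht1 : t ≠ 1 := by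
      rintro rfl
      rw [one_smul, sub_left_inj] at ht
      exact hbc (hm ht).symm
    obtain ⟨d, hd⟩ : ∃ d, ∀ s : ℝ, m d - m a ≠ s • (m b - m a) := by
      by_contra! hall
      apply hcop
      apply Collinear.coplanar
      rw [collinear_iff_of_mem (Set.mem_range_self a)]
      refine ⟨m b - m a, ?_⟩
      rintro _ ⟨d, rfl⟩
      obtain ⟨s, hs⟩ := hall d
      exact ⟨s, by rw [vadd_eq_add, ← hs]; abel⟩
    have hd0 : m d - m a ≠ 0 := by simpa using hd 0
    have hdb : ∀ s : ℝ, m b - m a ≠ s • (m d - m a) := by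
      intro s hs
      have hs0 : s ≠ 0 := by
        rintro rfl
        rw [zero_smul, sub_eq_zero] at hs
        exact hab (hm hs).symm
      apply hd s⁻¹
      rw [hs, smul_smul, inv_mul_cancel₀ hs0, one_smul]
    have had : a ≠ d := by
      rintro rfl
      simp at hd0
    rcases h a d had with ⟨L, r, hL, hr, hk, hl⟩ | ⟨L, hL, hdisj, -, hk⟩
    · obtain ⟨f, hf⟩ := cyl_lin L r hL hr _ _ hl
      have h1 := hf _ (hk b)
      have h2 := hf _ (hk c)
      rw [ht, QQ_smul, map_smul, ← h1, smul_eq_mul] at h2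
      have h3 : t * (t - 1) * QQ (m d - m a) (m b - m a) = 0 := by linarith
      have h4 : QQ (m d - m a) (m b - m a) = 0 := by
        simpa [ht0, sub_ne_zero.2 ht1] using h3
      obtain ⟨s, hs⟩ := QQ_zero hd0 h4
      exact hdb s hs
    · have hb : m b ∈ L := by
        rcases hk b with h' | h'
        · exact h'
        · obtain ⟨s, hs⟩ := mem_span_pair h'
          exact absurd hs (hdb s)
      have hc : m c ∈ L := by
        rcases hk c with h' | h'
        · exact h'
        · obtain ⟨s, hs⟩ := mem_span_pair h'
          refine absurd ?_ (hdb (t⁻¹ * s))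
          rw [← smul_smul, ← hs, ht, smul_smul, inv_mul_cancel₀ ht0, one_smul]
      have ha : m a ∈ L := by
        have hmem := AffineMap.lineMap_mem (t / (t - 1)) hc hb
        have ht1' : t - 1 ≠ 0 := sub_ne_zero.2 ht1
        have hcc : m c = m a + t • (m b - m a) := by rw [← ht]; abel
        rw [AffineMap.lineMap_apply, hcc] at hmem
        convert hmem using 1
        simp only [vsub_eq_sub, vadd_eq_add]
        ext q
        simp
        field_simp
        ring
      have : m a ∈ (L : Set E3) ∩ (affineSpan ℝ ({m a, m d} : Set E3) : Set E3) :=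
        ⟨ha, left_mem_affineSpan_pair ℝ _ _⟩
      rw [hdisj] at this
      exact this

end
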